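/- arXiv:1312.4335 — 4 statements merged into one kernel-verified Lean document; each statement's English description precedes it below -/
import Mathlib

section
/- Let n ≥ 1 and k ∈ ℕ with k < 2^n and binary digits k = Σ_{i=0}^{n−1} k_i 2^i. Then the number of sign changes of the Walsh–Paley function w_k on (0,1), namely the cardinality of {j ∈ {1,…,2^n−1} : w_k(j/2^n) ≠ w_k((j−1)/2^n)}, equals Σ_{r=0}^{n−1} ((Σ_{i=r}^{n−1} k_i) mod 2)·2^r. -/
/-- The `j`-th binary digit (`j ≥ 1`) of `x ∈ [0,1)`, using the terminating binary
expansion `x = Σ_{j≥1} x_j 2^{-j}` (the expansion ending in zeros for dyadic rationals). -/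
noncomputable def dyadicDigit (j : ℕ) (x : ℝ) : ℕ := (⌊x * 2 ^ j⌋).toNat % 2

/-- The Walsh–Paley function `w_k` on `[0,1)`: `w_k(x) = (-1) ^ (Σ_{i≥0} k_i x_{i+1})`,
where `k = Σ_i k_i 2^i` (all bits of `k` lie below `k + 1`). -/
noncomputable def walsh (k : ℕ) (x : ℝ) : ℝ :=
  (-1 : ℝ) ^ (∑ i ∈ Finset.range (k + 1), (k.testBit i).toNat * dyadicDigit (i + 1) x)

/-- `lastOnePos n x`: the largest index `r ∈ {1,…,n}` with `r`-th binary digit of `x`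
equal to `1` (the position of the last nonzero digit); by convention it is `1` for `x = 0`. -/
noncomputable def lastOnePos (n : ℕ) (x : ℝ) : ℕ :=
  if x = 0 then 1 else ((Finset.Icc 1 n).filter (fun r => dyadicDigit r x = 1)).sup id

/-- The Gray code map `G m = m XOR ⌊m/2⌋`. -/
def grayCode (m : ℕ) : ℕ := m ^^^ (m / 2)

/-- The sum of the `b m` with `m < N` and `2 ^ m ∣ j`. -/
def dvdSum (b : ℕ → ℕ) (N j : ℕ) : ℕ := ∑ m ∈ Finset.range N, if 2 ^ m ∣ j then b m else 0

theorem dvdSum_two_pow_add (b : ℕ → ℕ) (N : ℕ) {n j : ℕ} (hj : j ∈ Finset.Ico 1 (2 ^ n)) :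
    dvdSum b N (2 ^ n + j) = dvdSum b N j := by
  rw [Finset.mem_Ico] at hj
  refine Finset.sum_congr rfl fun m _ => ?_
  congr 1
  rw [eq_iff_iff]
  rcases le_or_gt m n with h | h
  · exact (Nat.dvd_add_iff_right (pow_dvd_pow 2 h)).symm
  · have hlt : 2 ^ (n + 1) ≤ 2 ^ m := Nat.pow_le_pow_right two_pos h
    rw [pow_succ] at hlt
    exact ⟨fun hd => absurd (Nat.le_of_dvd (by omega) hd) (by omega),
      fun hd => absurd (Nat.le_of_dvd (by omega) hd) (by omega)⟩

theorem dvdSum_two_pow (b : ℕ → ℕ) {N n : ℕ} (hn : n < N) :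
    dvdSum b N (2 ^ n) = ∑ m ∈ Finset.range (n + 1), b m := by
  rw [dvdSum, ← Finset.sum_filter]
  refine Finset.sum_congr ?_ fun _ _ => rfl
  ext m
  simp only [Finset.mem_filter, Finset.mem_range, Nat.pow_dvd_pow_iff_le_right (le_refl 2)]
  omega

theorem sum_dvdSum_mod_two (b : ℕ → ℕ) {N n : ℕ} (hn : n ≤ N) :
    ∑ j ∈ Finset.Ico 1 (2 ^ n), dvdSum b N j % 2 =
      ∑ m ∈ Finset.range n, ((∑ l ∈ Finset.range (m + 1), b l) % 2) * 2 ^ (n - 1 - m) := by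
  induction n with
  | zero => simp
  | succ n ih =>
    have hshift : ∑ j ∈ Finset.Ico (2 ^ n + 1) (2 ^ (n + 1)), dvdSum b N j % 2 =
        ∑ j ∈ Finset.Ico 1 (2 ^ n), dvdSum b N j % 2 := by
      have := Finset.sum_Ico_add (fun j => dvdSum b N j % 2) 1 (2 ^ n) (2 ^ n)
      rw [pow_succ, mul_two, add_comm _ 1, ← this]
      exact Finset.sum_congr rfl fun j hj => by rw [dvdSum_two_pow_add b N hj]
    have hpos : 1 ≤ 2 ^ n := Nat.one_le_two_pow
    have hlt : 2 ^ n < 2 ^ (n + 1) := Nat.pow_lt_pow_right one_lt_two n.lt_succ_self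
    rw [← Finset.sum_Ico_consecutive _ hpos hlt.le, Finset.sum_eq_sum_Ico_succ_bot hlt,
      hshift, ih (by omega), dvdSum_two_pow b (by omega),
      Finset.sum_range_succ (fun m => _ % 2 * 2 ^ (n + 1 - 1 - m))]
    have hdouble : ∑ m ∈ Finset.range n,
          ((∑ l ∈ Finset.range (m + 1), b l) % 2) * 2 ^ (n + 1 - 1 - m) =
        2 * ∑ m ∈ Finset.range n,
          ((∑ l ∈ Finset.range (m + 1), b l) % 2) * 2 ^ (n - 1 - m) := by
      rw [Finset.mul_sum]
      refine Finset.sum_congr rfl fun m hm => ?_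
      rw [Finset.mem_range] at hm
      rw [show n + 1 - 1 - m = n - 1 - m + 1 by omega, pow_succ]
      ring
    rw [hdouble]
    simp only [Nat.add_sub_cancel, Nat.sub_self, pow_zero, mul_one]
    ring

theorem dyadicDigit_div_two_pow {n m : ℕ} (hm : m < n) (j : ℕ) :
    dyadicDigit (n - 1 - m + 1) ((j : ℝ) / 2 ^ n) = j / 2 ^ m % 2 := by
  have h : (j : ℝ) / 2 ^ n * 2 ^ (n - 1 - m + 1) = (j : ℝ) / ((2 ^ m : ℕ) : ℝ) := by
    have hn : (2 : ℝ) ^ n = 2 ^ (n - 1 - m + 1) * 2 ^ m := by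
      rw [← pow_add]
      congr 1
      omega
    rw [hn]
    push_cast
    field_simp
  rw [dyadicDigit, h, Int.floor_toNat, Nat.floor_div_eq_div]

theorem sum_range_testBit_mul {k N M : ℕ} (hk : k < 2 ^ N) (hNM : N ≤ M) (f : ℕ → ℕ) :
    ∑ i ∈ Finset.range N, (k.testBit i).toNat * f i =
      ∑ i ∈ Finset.range M, (k.testBit i).toNat * f i := by
  refine Finset.sum_subset (Finset.range_mono hNM) fun i _ hi => ?_
  rw [Finset.mem_range, not_lt] at hi
  rw [Nat.testBit_lt_two_pow (hk.trans_le (Nat.pow_le_pow_right two_pos hi))]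
  simp

/-- Reading the digits of `j` from the lowest one up, the exponent of the Walsh function at
`j / 2 ^ n` may be computed without reducing the digits modulo two. -/
theorem walsh_div_two_pow {n k : ℕ} (hk : k < 2 ^ n) (j : ℕ) :
    walsh k ((j : ℝ) / 2 ^ n) =
      (-1) ^ ∑ m ∈ Finset.range n, (k.testBit (n - 1 - m)).toNat * (j / 2 ^ m) := by
  have htrunc : ∑ i ∈ Finset.range (k + 1),
        (k.testBit i).toNat * dyadicDigit (i + 1) ((j : ℝ) / 2 ^ n) =
      ∑ i ∈ Finset.range n, (k.testBit i).toNat * dyadicDigit (i + 1) ((j : ℝ) / 2 ^ n) := by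
    rw [sum_range_testBit_mul (k.lt_two_pow_self.trans (Nat.pow_lt_pow_succ one_lt_two))
        (le_max_left (k + 1) n), sum_range_testBit_mul hk (le_max_right (k + 1) n)]
  rw [walsh, htrunc, ← Finset.sum_range_reflect, neg_one_pow_eq_pow_mod_two,
    neg_one_pow_eq_pow_mod_two (n := ∑ m ∈ Finset.range n, _)]
  congr 1
  rw [Finset.sum_nat_mod, Finset.sum_nat_mod _ _ fun m => (k.testBit (n - 1 - m)).toNat * (j / 2 ^ m)]
  congr 1
  refine Finset.sum_congr rfl fun m hm => ?_
  rw [dyadicDigit_div_two_pow (Finset.mem_range.1 hm), Nat.mul_mod_mod]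

theorem walsh_ne_iff {n k : ℕ} (hk : k < 2 ^ n) {j : ℕ} (hj : 1 ≤ j) :
    walsh k ((j : ℝ) / 2 ^ n) ≠ walsh k (((j - 1 : ℕ) : ℝ) / 2 ^ n) ↔
      dvdSum (fun m => (k.testBit (n - 1 - m)).toNat) n j % 2 = 1 := by
  obtain ⟨j, rfl⟩ := Nat.exists_eq_add_of_le' hj
  have hstep : ∑ m ∈ Finset.range n, (k.testBit (n - 1 - m)).toNat * ((j + 1) / 2 ^ m) =
      ∑ m ∈ Finset.range n, (k.testBit (n - 1 - m)).toNat * (j / 2 ^ m) +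
        dvdSum (fun m => (k.testBit (n - 1 - m)).toNat) n (j + 1) := by
    rw [dvdSum, ← Finset.sum_add_distrib]
    refine Finset.sum_congr rfl fun m _ => ?_
    rw [Nat.succ_div]
    split_ifs <;> ring
  rw [Nat.add_sub_cancel, walsh_div_two_pow hk, walsh_div_two_pow hk, hstep, pow_add,
    ← Nat.odd_iff]
  rcases Nat.even_or_odd (dvdSum (fun m => (k.testBit (n - 1 - m)).toNat) n (j + 1)) with h | h
  · simp [h.neg_one_pow, Nat.not_odd_iff_even.2 h]
  · simp [h.neg_one_pow, h, neg_eq_iff_add_eq_zero]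

open scoped Classical in
/-- for `n ≥ 1` and `k < 2^n`, the number of sign changes of `w_k` on
`(0,1)` equals `Σ_{r<n} ((Σ_{i=r}^{n-1} k_i) mod 2)·2^r`. -/
theorem card_sign_changes (n k : ℕ) (hn : 1 ≤ n) (hk : k < 2 ^ n) :
    ((Finset.Icc 1 (2 ^ n - 1)).filter
        (fun j : ℕ => walsh k ((j : ℝ) / 2 ^ n) ≠ walsh k (((j - 1 : ℕ) : ℝ) / 2 ^ n))).card
      = ∑ r ∈ Finset.range n,
          ((∑ i ∈ Finset.Icc r (n - 1), (k.testBit i).toNat) % 2) * 2 ^ r := by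
  have hIco : Finset.Icc 1 (2 ^ n - 1) = Finset.Ico 1 (2 ^ n) := by
    have := Nat.two_pow_pos n
    ext j
    simp only [Finset.mem_Icc, Finset.mem_Ico]
    omega
  rw [hIco, Finset.card_filter]
  trans ∑ j ∈ Finset.Ico 1 (2 ^ n), dvdSum (fun m => (k.testBit (n - 1 - m)).toNat) n j % 2
  · refine Finset.sum_congr rfl fun j hj => ?_
    rw [if_congr (walsh_ne_iff hk (Finset.mem_Ico.1 hj).1) rfl rfl]
    split_ifs <;> omega
  rw [sum_dvdSum_mod_two _ le_rfl,
    ← Finset.sum_range_reflect (fun r =>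
      ((∑ i ∈ Finset.Icc r (n - 1), (k.testBit i).toNat) % 2) * 2 ^ r)]
  refine Finset.sum_congr rfl fun m hm => ?_
  rw [Finset.mem_range] at hm
  congr 2
  refine Finset.sum_nbij' (fun l => n - 1 - l) (fun i => n - 1 - i) ?_ ?_ ?_ ?_ ?_ <;>
    simp only [Finset.mem_range, Finset.mem_Icc] <;> intros <;> first | trivial | omega
end

section
/- Let n ≥ 1 and m ∈ ℕ with 0 ≤ m < 2^n. Then the Walsh–Paley function w_{Gm}, where Gm = m XOR ⌊m/2⌋, has exactly m sign changes on (0,1): the cardinality of {j ∈ {1,…,2^n−1} : w_{Gm}(j/2^n) ≠ w_{Gm}((j−1)/2^n)} equals m. (Thus k ↦ w_{Gk} enumerates the Walsh functions in increasing sequency.) -/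
open Finset

/-- The exponent, modulo `2`, of `w_k (j / 2 ^ n)` when `k < 2 ^ n`. -/
def walshParity (n k j : ℕ) : ZMod 2 :=
  ∑ i ∈ range n, ((k.testBit i).toNat : ZMod 2) * ((j / 2 ^ (n - 1 - i) : ℕ) : ZMod 2)

theorem walshParity_succ (n k j : ℕ) :
    walshParity (n + 1) k j =
      walshParity n k (j / 2) + ((k.testBit n).toNat : ZMod 2) * (j : ZMod 2) := by
  unfold walshParity
  rw [sum_range_succ]
  congr 1
  · refine sum_congr rfl fun i hi => ?_
    have hi := mem_range.1 hi
    rw [Nat.div_div_eq_div_mul, ← pow_succ', show n - 1 - i + 1 = n + 1 - 1 - i by omega]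
  · simp

theorem dyadicDigit_natCast_div {n i : ℕ} (hi : i < n) (j : ℕ) :
    dyadicDigit (i + 1) ((j : ℝ) / 2 ^ n) = j / 2 ^ (n - 1 - i) % 2 := by
  have h : (j : ℝ) / 2 ^ n * 2 ^ (i + 1) = (j : ℝ) / ((2 ^ (n - 1 - i) : ℕ) : ℝ) := by
    obtain ⟨d, rfl⟩ := Nat.exists_eq_add_of_lt hi
    rw [show i + d + 1 - 1 - i = d by omega, show i + d + 1 = (i + 1) + d by omega, pow_add]
    push_cast
    field_simp
  rw [dyadicDigit, h, Int.floor_toNat, Nat.floor_div_natCast, Nat.floor_natCast]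

theorem sum_testBit_mul_eq {k M N : ℕ} (hM : k < 2 ^ M) (hMN : M ≤ N) (d : ℕ → ℕ) :
    ∑ i ∈ range N, (k.testBit i).toNat * d i = ∑ i ∈ range M, (k.testBit i).toNat * d i := by
  refine (sum_subset (range_mono hMN) fun i _ hi => ?_).symm
  have hk : k < 2 ^ i := hM.trans_le (Nat.pow_le_pow_right two_pos (by simpa using hi))
  simp [Nat.testBit_lt_two_pow hk]

theorem neg_one_pow_eq_iff_natCast (a b : ℕ) :
    (-1 : ℝ) ^ a = (-1) ^ b ↔ (a : ZMod 2) = b := by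
  rw [ZMod.natCast_eq_natCast_iff']
  rcases Nat.even_or_odd a with ha | ha <;> rcases Nat.even_or_odd b with hb | hb <;>
    rw [ha.neg_one_pow, hb.neg_one_pow] <;> norm_num <;> grind

theorem walsh_natCast_div_eq_iff {n k : ℕ} (hk : k < 2 ^ n) (a b : ℕ) :
    walsh k ((a : ℝ) / 2 ^ n) = walsh k ((b : ℝ) / 2 ^ n) ↔
      walshParity n k a = walshParity n k b := by
  have key (j : ℕ) : ((∑ i ∈ range (k + 1), (k.testBit i).toNat *
      dyadicDigit (i + 1) ((j : ℝ) / 2 ^ n) : ℕ) : ZMod 2) = walshParity n k j := by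
    have hk' : k < 2 ^ (k + 1) := Nat.lt_two_pow_self.trans (Nat.pow_lt_pow_succ one_lt_two)
    rw [← sum_testBit_mul_eq hk' (le_max_left (k + 1) n),
      sum_testBit_mul_eq hk (le_max_right (k + 1) n), walshParity, Nat.cast_sum]
    refine sum_congr rfl fun i hi => ?_
    rw [dyadicDigit_natCast_div (mem_range.1 hi), Nat.cast_mul, ZMod.natCast_mod]
  rw [walsh, walsh, neg_one_pow_eq_iff_natCast, key, key]

theorem grayCode_lt_two_pow {n m : ℕ} (hm : m < 2 ^ n) : grayCode m < 2 ^ n :=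
  Nat.xor_lt_two_pow hm ((Nat.div_le_self m 2).trans_lt hm)

theorem testBit_grayCode_toNat (m i : ℕ) :
    (((grayCode m).testBit i).toNat : ZMod 2) =
      (m.testBit i).toNat + (m.testBit (i + 1)).toNat := by
  rw [grayCode, Nat.testBit_xor, Nat.testBit_div_two]
  cases m.testBit i <;> cases m.testBit (i + 1) <;> decide

/-- The increment of `walshParity` between `j - 1` and `j` for the index `grayCode m`, corrected
by the bit of `m` at position `n` so that no bound on `m` is needed. -/
def grayIncrement (n m j : ℕ) : ZMod 2 :=
  walshParity n (grayCode m) j + walshParity n (grayCode m) (j - 1) + (m.testBit n).toNat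

theorem grayIncrement_two_mul (n m : ℕ) {j : ℕ} (hj : 1 ≤ j) :
    grayIncrement (n + 1) m (2 * j) = grayIncrement n m j := by
  obtain ⟨j, rfl⟩ := Nat.exists_eq_add_of_le' hj
  simp only [grayIncrement, walshParity_succ, testBit_grayCode_toNat]
  rw [show 2 * (j + 1) / 2 = j + 1 by omega, show (2 * (j + 1) - 1) / 2 = j + 1 - 1 by omega,
    show 2 * (j + 1) - 1 = 2 * j + 1 by omega]
  push_cast
  linear_combination ((j + 1 + j) * ((m.testBit n).toNat +
    (m.testBit (n + 1)).toNat) + (m.testBit (n + 1)).toNat : ZMod 2) * CharTwo.two_eq_zero (R := ZMod 2)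

theorem grayIncrement_two_mul_add_one (n m j : ℕ) :
    grayIncrement (n + 1) m (2 * j + 1) = (m.testBit n).toNat := by
  simp only [grayIncrement, walshParity_succ, testBit_grayCode_toNat]
  rw [show (2 * j + 1) / 2 = j by omega, show (2 * j + 1 - 1) / 2 = j by omega,
    show 2 * j + 1 - 1 = 2 * j by omega]
  push_cast
  linear_combination (walshParity n (grayCode m) j +
    2 * j * ((m.testBit n).toNat + (m.testBit (n + 1)).toNat) +
    (m.testBit (n + 1)).toNat : ZMod 2) * CharTwo.two_eq_zero (R := ZMod 2)

theorem sum_Ico_one_two_mul {M : Type*} [AddCommMonoid M] (h : ℕ → M) {N : ℕ} (hN : 1 ≤ N) :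
    ∑ j ∈ Ico 1 (2 * N), h j = ∑ j ∈ Ico 1 N, h (2 * j) + ∑ j ∈ range N, h (2 * j + 1) := by
  induction N, hN using Nat.le_induction with
  | base => simp
  | succ N hN ih =>
    rw [show 2 * (N + 1) = 2 * N + 1 + 1 by ring, sum_Ico_succ_top (by omega),
      sum_Ico_succ_top (by omega), ih, sum_Ico_succ_top hN, sum_range_succ]
    abel

theorem card_grayIncrement_ne_zero (n m : ℕ) :
    #{j ∈ Ico 1 (2 ^ n) | grayIncrement n m j ≠ 0} = m % 2 ^ n := by
  induction n with
  | zero => simp [Nat.mod_one]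
  | succ n ih =>
    rw [card_filter] at ih ⊢
    rw [pow_succ', sum_Ico_one_two_mul _ Nat.one_le_two_pow, ← pow_succ', Nat.mod_pow_succ,
      ← Nat.toNat_testBit, ← ih]
    congr 1
    · exact sum_congr rfl fun j hj => by rw [grayIncrement_two_mul n m (mem_Ico.1 hj).1]
    · simp only [grayIncrement_two_mul_add_one]
      cases m.testBit n <;> simp

open scoped Classical in
/-- for `n ≥ 1` and `m < 2^n`, the Walsh function `w_{Gm}` has exactly `m`
sign changes on `(0,1)`; thus `m ↦ w_{Gm}` enumerates the Walsh functions in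
increasing sequency. -/
theorem walsh_grayCode_sequency (n m : ℕ) (hn : 1 ≤ n) (hm : m < 2 ^ n) :
    ((Finset.Icc 1 (2 ^ n - 1)).filter
        (fun j : ℕ => walsh (grayCode m) ((j : ℝ) / 2 ^ n) ≠
          walsh (grayCode m) (((j - 1 : ℕ) : ℝ) / 2 ^ n))).card = m := by
  have hIcc : Icc 1 (2 ^ n - 1) = Ico 1 (2 ^ n) := by
    ext j
    have := Nat.one_le_two_pow (n := n)
    simp only [mem_Icc, mem_Ico]
    omega
  conv_rhs => rw [← Nat.mod_eq_of_lt hm, ← card_grayIncrement_ne_zero n m]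
  rw [hIcc]
  congr 1
  refine filter_congr fun j _ => not_congr ?_
  rw [walsh_natCast_div_eq_iff (grayCode_lt_two_pow hm), grayIncrement,
    Nat.testBit_lt_two_pow hm, Bool.toNat_false, Nat.cast_zero, add_zero, CharTwo.add_eq_zero]
end

section
/- Let n ≥ 1 and k ∈ ℕ with k < 2^n. Then the diagonal Walsh entries of the two cyclic translations agree: Σ_{j=0}^{2^n−1} w_k(((j−1) mod 2^n)/2^n) · w_k(j/2^n) = Σ_{j=0}^{2^n−1} w_k(((j+1) mod 2^n)/2^n) · w_k(j/2^n). Consequently, the best approximation in Hilbert–Schmidt norm of the symmetric difference operator 2^{n−1}(T_{2^{−n}} − T_{−2^{−n}}) (where (T_{2^{−n}} g)(j) = g((j−1) mod 2^n) and (T_{−2^{−n}} g)(j) = g((j+1) mod 2^n)) by a dyadic convolution operator is the zero operator. -/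
/-- The Walsh vector `W_k ∈ ℂ^{2^n}`, `W_k(j) = w_k(j/2^n)`. -/
noncomputable def walshVec (n k : ℕ) : Fin (2 ^ n) → ℂ :=
  fun j => ((walsh k ((j : ℝ) / 2 ^ n) : ℝ) : ℂ)

/-- Dyadic convolution on `ℂ^{2^n}`: `(f ∗ g)(j) = 2^{-n} Σ_t f(j XOR t) g(t)`. -/
noncomputable def dconv (n : ℕ) (f g : Fin (2 ^ n) → ℂ) : Fin (2 ^ n) → ℂ :=
  fun j => (2 ^ n : ℂ)⁻¹ *
    ∑ t : Fin (2 ^ n), f ⟨j.val ^^^ t.val, Nat.xor_lt_two_pow j.isLt t.isLt⟩ * g t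

/-- The Walsh coefficients `f^∼(k) = 2^{-n} Σ_j f(j) w_k(j/2^n)` of `f ∈ ℂ^{2^n}`. -/
noncomputable def walshCoeff (n : ℕ) (f : Fin (2 ^ n) → ℂ) (k : ℕ) : ℂ :=
  (2 ^ n : ℂ)⁻¹ * ∑ j : Fin (2 ^ n), f j * ((walsh k ((j : ℝ) / 2 ^ n) : ℝ) : ℂ)

/-- The normalized inner product `⟨u,v⟩ = 2^{-n} Σ_j u(j) conj(v(j))` on `ℂ^{2^n}`. -/
noncomputable def ninner (n : ℕ) (u v : Fin (2 ^ n) → ℂ) : ℂ :=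
  (2 ^ n : ℂ)⁻¹ * ∑ j : Fin (2 ^ n), u j * (starRingEnd ℂ) (v j)

/-- The squared Hilbert–Schmidt norm `Σ_λ ‖A e_λ‖²` of an operator `A` on `ℂ^{2^n}`,
computed with respect to the normalized inner product `ninner`, using the orthonormal
basis `e_j = 2^{n/2} δ_j` (so `‖A e_j‖² = 2^n ⟨A δ_j, A δ_j⟩`). -/
noncomputable def hsNormSq (n : ℕ) (A : (Fin (2 ^ n) → ℂ) → (Fin (2 ^ n) → ℂ)) : ℝ :=
  ∑ j : Fin (2 ^ n), (2 ^ n : ℝ) * (ninner n (A (Pi.single j 1)) (A (Pi.single j 1))).re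

/-- The index `(j - 1) mod 2^n`. -/
def predIdx (n : ℕ) (j : Fin (2 ^ n)) : Fin (2 ^ n) :=
  ⟨(j.val + (2 ^ n - 1)) % 2 ^ n, Nat.mod_lt _ (Nat.two_pow_pos n)⟩

/-- The index `(j + 1) mod 2^n`. -/
def succIdx (n : ℕ) (j : Fin (2 ^ n)) : Fin (2 ^ n) :=
  ⟨(j.val + 1) % 2 ^ n, Nat.mod_lt _ (Nat.two_pow_pos n)⟩

/-- The symmetric difference operator `2^{n-1}(T_{2^{-n}} - T_{-2^{-n}})` on `ℂ^{2^n}`,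
where `(T_{2^{-n}} g)(j) = g((j-1) mod 2^n)` and `(T_{-2^{-n}} g)(j) = g((j+1) mod 2^n)`. -/
noncomputable def symmDiffOp (n : ℕ) (v : Fin (2 ^ n) → ℂ) : Fin (2 ^ n) → ℂ :=
  fun j => (2 ^ (n - 1) : ℂ) * (v (predIdx n j) - v (succIdx n j))

theorem predIdx_succIdx (n : ℕ) (j : Fin (2 ^ n)) : predIdx n (succIdx n j) = j := by
  have hj := j.isLt
  have hpos := Nat.two_pow_pos n
  ext
  simp only [predIdx, succIdx, Nat.mod_add_mod]
  rw [show j.val + 1 + (2 ^ n - 1) = j.val + 2 ^ n by omega, Nat.add_mod_right,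
    Nat.mod_eq_of_lt hj]

theorem succIdx_predIdx (n : ℕ) (j : Fin (2 ^ n)) : succIdx n (predIdx n j) = j := by
  have hj := j.isLt
  have hpos := Nat.two_pow_pos n
  ext
  simp only [predIdx, succIdx, Nat.mod_add_mod]
  rw [show j.val + (2 ^ n - 1) + 1 = j.val + 2 ^ n by omega, Nat.add_mod_right,
    Nat.mod_eq_of_lt hj]

/-- The cyclic translation `j ↦ (j + 1) mod 2^n` as a permutation of the indices. -/
def succIdxEquiv (n : ℕ) : Equiv.Perm (Fin (2 ^ n)) where
  toFun := succIdx n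
  invFun := predIdx n
  left_inv := predIdx_succIdx n
  right_inv := succIdx_predIdx n

theorem predIdx_eq_iff (n : ℕ) (i j : Fin (2 ^ n)) : predIdx n i = j ↔ succIdx n j = i := by
  constructor
  · rintro rfl
    exact succIdx_predIdx n i
  · rintro rfl
    exact predIdx_succIdx n j

/-- The autocorrelation of a function on the cyclic group is invariant under negating the lag. -/
theorem sum_pred_mul_eq_sum_succ_mul (n : ℕ) (u : ℕ → ℝ) :
    ∑ j ∈ Finset.range (2 ^ n), u ((j + 2 ^ n - 1) % 2 ^ n) * u j
      = ∑ j ∈ Finset.range (2 ^ n), u ((j + 1) % 2 ^ n) * u j := by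
  rw [Finset.sum_range, Finset.sum_range, ← Equiv.sum_comp (succIdxEquiv n)]
  refine Finset.sum_congr rfl fun j _ => ?_
  have hpred := congrArg Fin.val (predIdx_succIdx n j)
  simp only [predIdx] at hpred
  rw [← Nat.add_sub_assoc Nat.one_le_two_pow] at hpred
  change u (((succIdx n j).val + 2 ^ n - 1) % 2 ^ n) * u ((j.val + 1) % 2 ^ n) = _
  rw [hpred, mul_comm]

theorem hsNormSq_eq_sum_normSq (n : ℕ) (A : (Fin (2 ^ n) → ℂ) → (Fin (2 ^ n) → ℂ)) :
    hsNormSq n A = ∑ j, ∑ i, Complex.normSq (A (Pi.single j 1) i) := by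
  refine Finset.sum_congr rfl fun j _ => ?_
  simp only [ninner, Complex.mul_conj]
  rw [← Complex.ofReal_sum,
    show ((2 : ℂ) ^ n)⁻¹ = (((2 : ℝ) ^ n)⁻¹ : ℝ) by push_cast; rfl, ← Complex.ofReal_mul,
    Complex.ofReal_re, mul_inv_cancel_left₀ (by positivity)]

theorem dconv_single (n : ℕ) (f : Fin (2 ^ n) → ℂ) (i j : Fin (2 ^ n)) :
    dconv n f (Pi.single j 1) i
      = (2 ^ n : ℂ)⁻¹ * f ⟨i.val ^^^ j.val, Nat.xor_lt_two_pow i.isLt j.isLt⟩ := by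
  simp [dconv, Pi.single_apply]

theorem dconv_single_comm (n : ℕ) (f : Fin (2 ^ n) → ℂ) (i j : Fin (2 ^ n)) :
    dconv n f (Pi.single j 1) i = dconv n f (Pi.single i 1) j := by
  simp only [dconv_single, Nat.xor_comm]

theorem symmDiffOp_single_antisymm (n : ℕ) (i j : Fin (2 ^ n)) :
    symmDiffOp n (Pi.single j 1) i = -symmDiffOp n (Pi.single i 1) j := by
  simp only [symmDiffOp, Pi.single_apply, predIdx_eq_iff]
  ring

/-- Antisymmetric and symmetric matrices are orthogonal for the Hilbert–Schmidt norm. -/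
theorem sum_normSq_sub_of_antisymm_of_symm {ι : Type*} [Fintype ι] (D C : ι → ι → ℂ)
    (hD : ∀ i j, D i j = -D j i) (hC : ∀ i j, C i j = C j i) :
    ∑ i, ∑ j, Complex.normSq (D i j - C i j)
      = ∑ i, ∑ j, Complex.normSq (D i j) + ∑ i, ∑ j, Complex.normSq (C i j) := by
  have hswap : ∑ i, ∑ j, Complex.normSq (D i j - C i j)
      = ∑ i, ∑ j, Complex.normSq (D i j + C i j) := by
    rw [Finset.sum_comm]
    refine Finset.sum_congr rfl fun i _ => Finset.sum_congr rfl fun j _ => ?_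
    rw [hD j i, hC j i, ← Complex.normSq_neg]
    congr 1
    ring
  have hpar : ∑ i, ∑ j, Complex.normSq (D i j - C i j)
      + ∑ i, ∑ j, Complex.normSq (D i j + C i j)
      = 2 * (∑ i, ∑ j, Complex.normSq (D i j) + ∑ i, ∑ j, Complex.normSq (C i j)) := by
    simp only [← Finset.sum_add_distrib, Finset.mul_sum]
    refine Finset.sum_congr rfl fun i _ => Finset.sum_congr rfl fun j _ => ?_
    rw [Complex.normSq_sub, Complex.normSq_add]
    ring
  linarith

theorem hsNormSq_symmDiffOp_sub_dconv (n : ℕ) (f : Fin (2 ^ n) → ℂ) :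
    hsNormSq n (fun v => symmDiffOp n v - dconv n f v)
      = hsNormSq n (symmDiffOp n) + hsNormSq n (dconv n f) := by
  simp only [hsNormSq_eq_sum_normSq, Pi.sub_apply]
  exact sum_normSq_sub_of_antisymm_of_symm (fun j i => symmDiffOp n (Pi.single j 1) i)
    (fun j i => dconv n f (Pi.single j 1) i)
    (fun j i => symmDiffOp_single_antisymm n i j) (fun j i => dconv_single_comm n f i j)

theorem hsNormSq_nonneg (n : ℕ) (A : (Fin (2 ^ n) → ℂ) → (Fin (2 ^ n) → ℂ)) :
    0 ≤ hsNormSq n A := by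
  rw [hsNormSq_eq_sum_normSq]
  exact Finset.sum_nonneg fun _ _ => Finset.sum_nonneg fun _ _ => Complex.normSq_nonneg _

theorem hsNormSq_dconv_eq_zero_iff (n : ℕ) (f : Fin (2 ^ n) → ℂ) :
    hsNormSq n (dconv n f) = 0 ↔ ∀ g, dconv n f g = 0 := by
  rw [hsNormSq_eq_sum_normSq]
  constructor
  · intro h g
    rw [Finset.sum_eq_zero_iff_of_nonneg
      fun _ _ => Finset.sum_nonneg fun _ _ => Complex.normSq_nonneg _] at h
    funext i
    simp only [dconv, Pi.zero_apply]
    rw [Finset.mul_sum]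
    refine Finset.sum_eq_zero fun t _ => ?_
    have ht := h t (Finset.mem_univ t)
    rw [Finset.sum_eq_zero_iff_of_nonneg fun _ _ => Complex.normSq_nonneg _] at ht
    have hit := Complex.normSq_eq_zero.mp (ht i (Finset.mem_univ i))
    rw [dconv_single] at hit
    rw [← mul_assoc, hit, zero_mul]
  · intro h
    simp [h]

/-- for `n ≥ 1` and `k < 2^n` the diagonal Walsh entries of the two cyclic
translations agree; consequently the best HS-approximation of the symmetric difference
operator `2^{n-1}(T_{2^{-n}} - T_{-2^{-n}})` by a dyadic convolution operator is the
zero operator. -/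
theorem best_approx_symm_difference (n : ℕ) (hn : 1 ≤ n) :
    (∀ k < 2 ^ n,
      ∑ j ∈ Finset.range (2 ^ n),
          walsh k ((((j + 2 ^ n - 1) % 2 ^ n : ℕ) : ℝ) / 2 ^ n) * walsh k ((j : ℝ) / 2 ^ n)
        = ∑ j ∈ Finset.range (2 ^ n),
            walsh k ((((j + 1) % 2 ^ n : ℕ) : ℝ) / 2 ^ n) * walsh k ((j : ℝ) / 2 ^ n)) ∧
    (∀ f : Fin (2 ^ n) → ℂ,
      (∀ g : Fin (2 ^ n) → ℂ,
          hsNormSq n (fun v => symmDiffOp n v - dconv n f v)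
            ≤ hsNormSq n (fun v => symmDiffOp n v - dconv n g v))
        ↔ ∀ g : Fin (2 ^ n) → ℂ, dconv n f g = 0) := by
  refine ⟨fun k _ => sum_pred_mul_eq_sum_succ_mul n fun j => walsh k ((j : ℝ) / 2 ^ n),
    fun f => ?_⟩
  simp only [hsNormSq_symmDiffOp_sub_dconv, add_le_add_iff_left]
  rw [← hsNormSq_dconv_eq_zero_iff]
  constructor
  · intro h
    have hzero : hsNormSq n (dconv n 0) = 0 :=
      (hsNormSq_dconv_eq_zero_iff n 0).mpr fun g => by funext i; simp [dconv]
    exact le_antisymm (hzero ▸ h 0) (hsNormSq_nonneg n _)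
  · intro h g
    exact h ▸ hsNormSq_nonneg n _
end

section
/- Let J be the anti-differentiation (Volterra) operator on L²([0,1]), J f(x) = ∫_0^x f(t) dt. Then for every integer k ≥ 1 the diagonal Walsh entry of J vanishes: ∫_0^1 (∫_0^x w_k(t) dt) · w_k(x) dx = 0, while for k = 0 one has ∫_0^1 (∫_0^x w_0(t) dt) · w_0(x) dx = 1/2. Consequently, the best approximation of J by a dyadic convolution operator in Hilbert–Schmidt norm is the rank-one operator f ↦ (1/2) ∫_0^1 f(λ) dλ. -/
section WalshPrimitive

open MeasureTheory Set Filter Topology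

lemma dyadicDigit_succ (j : ℕ) (x : ℝ) : dyadicDigit (j + 1) x = dyadicDigit j (2 * x) := by
  rw [dyadicDigit, dyadicDigit, pow_succ', ← mul_assoc, mul_comm x 2]

lemma dyadicDigit_add_one {j : ℕ} (hj : j ≠ 0) {x : ℝ} (hx : 0 ≤ x) :
    dyadicDigit j (x + 1) = dyadicDigit j x := by
  unfold dyadicDigit
  have hfloor : ⌊(x + 1) * 2 ^ j⌋ = ⌊x * 2 ^ j⌋ + ((2 ^ j : ℕ) : ℤ) := by
    rw [← Int.floor_add_natCast]
    push_cast
    ring_nf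
  have hnonneg : 0 ≤ ⌊x * 2 ^ j⌋ := Int.floor_nonneg.mpr (by positivity)
  have heven : 2 ∣ 2 ^ j := dvd_pow_self 2 hj
  rw [hfloor, Int.toNat_add hnonneg (Int.natCast_nonneg _), Int.toNat_natCast]
  omega

lemma walsh_zero (x : ℝ) : walsh 0 x = 1 := by
  simp [walsh]

lemma walsh_mul_self (k : ℕ) (x : ℝ) : walsh k x * walsh k x = 1 := by
  rw [walsh, ← mul_pow]
  simp

lemma abs_walsh (k : ℕ) (x : ℝ) : |walsh k x| = 1 := by
  simp [walsh]

lemma measurable_dyadicDigit (j : ℕ) : Measurable (dyadicDigit j) := by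
  have hdigit : Measurable fun n : ℤ => n.toNat % 2 := measurable_of_countable _
  exact hdigit.comp (Int.measurable_floor.comp (measurable_id.mul_const _))

lemma measurable_walsh (k : ℕ) : Measurable (walsh k) := by
  have hpow : Measurable fun n : ℕ => (-1 : ℝ) ^ n := measurable_of_countable _
  exact hpow.comp (Finset.measurable_sum _ fun i _ => (measurable_dyadicDigit (i + 1)).const_mul _)

lemma intervalIntegrable_walsh (k : ℕ) (a b : ℝ) : IntervalIntegrable (walsh k) volume a b :=
  (intervalIntegrable_const (c := (1 : ℝ))).mono_fun' (measurable_walsh k).aestronglyMeasurable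
    (ae_of_all _ fun x => (abs_walsh k x).le)

lemma dyadicDigit_eventuallyEq (j : ℕ) (x : ℝ) :
    ∀ᶠ y in 𝓝[≥] x, dyadicDigit j y = dyadicDigit j x := by
  have hscale : Tendsto (fun y : ℝ => y * 2 ^ j) (𝓝[≥] x) (𝓝[≥] (x * 2 ^ j)) := by
    refine tendsto_nhdsWithin_iff.mpr ⟨?_, ?_⟩
    · exact ((continuous_mul_const _).tendsto x).mono_left nhdsWithin_le_nhds
    · filter_upwards [self_mem_nhdsWithin] with y hy
      exact mul_le_mul_of_nonneg_right (mem_Ici.mp hy) (pow_nonneg zero_le_two j)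
  have hfloor := tendsto_pure.mp ((tendsto_floor_right_pure_floor (x * 2 ^ j)).comp hscale)
  filter_upwards [hfloor] with y hy
  simp only [Function.comp_apply] at hy
  rw [dyadicDigit, hy, dyadicDigit]

/-- Walsh functions are continuous from the right. -/
lemma continuousWithinAt_walsh_Ici (k : ℕ) (x : ℝ) : ContinuousWithinAt (walsh k) (Ici x) x := by
  have hdigits : ∀ᶠ y in 𝓝[≥] x, ∀ i ∈ Finset.range (k + 1),
      dyadicDigit (i + 1) y = dyadicDigit (i + 1) x :=
    (Finset.eventually_all _).mpr fun i _ => dyadicDigit_eventuallyEq (i + 1) x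
  refine tendsto_const_nhds.congr' ?_
  filter_upwards [hdigits] with y hy
  rw [walsh, walsh]
  exact congrArg _ (Finset.sum_congr rfl fun i hi => by rw [hy i hi])

lemma walsh_eq_mul_walsh_half {k : ℕ} (hk : 1 ≤ k) (x : ℝ) :
    walsh k x = (-1) ^ ((k.testBit 0).toNat * dyadicDigit 1 x) * walsh (k / 2) (2 * x) := by
  have hsum : ∑ i ∈ Finset.range (k / 2 + 1),
        ((k / 2).testBit i).toNat * dyadicDigit (i + 1) (2 * x) =
      ∑ i ∈ Finset.range k, ((k / 2).testBit i).toNat * dyadicDigit (i + 1) (2 * x) := by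
    refine Finset.sum_subset (Finset.range_subset_range.mpr (by omega)) fun i _ hi => ?_
    have hlt : k / 2 < 2 ^ i :=
      lt_trans (by simpa [Nat.lt_succ_iff] using hi) Nat.lt_two_pow_self
    simp [Nat.testBit_lt_two_pow hlt]
  rw [walsh, walsh, ← pow_add, Finset.sum_range_succ', add_comm, hsum]
  simp only [Nat.testBit_succ, dyadicDigit_succ (_ + 1) x]

lemma walsh_add_one (k : ℕ) {x : ℝ} (hx : 0 ≤ x) : walsh k (x + 1) = walsh k x := by
  simp only [walsh, dyadicDigit_add_one (Nat.succ_ne_zero _) hx]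

lemma dyadicDigit_one_of_lt_half {x : ℝ} (h0 : 0 ≤ x) (h1 : x < 1 / 2) : dyadicDigit 1 x = 0 := by
  have hfloor : ⌊x * 2 ^ 1⌋ = 0 := by
    rw [Int.floor_eq_iff]
    constructor <;> push_cast <;> linarith
  rw [dyadicDigit, hfloor]
  rfl

lemma dyadicDigit_one_of_half_le {x : ℝ} (h0 : 1 / 2 ≤ x) (h1 : x < 1) : dyadicDigit 1 x = 1 := by
  have hfloor : ⌊x * 2 ^ 1⌋ = 1 := by
    rw [Int.floor_eq_iff]
    constructor <;> push_cast <;> linarith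
  rw [dyadicDigit, hfloor]
  rfl

lemma integral_walsh_eq_half {k : ℕ} (hk : 1 ≤ k) :
    ∫ x in (0 : ℝ)..1, walsh k x =
      (1 + (-1) ^ (k.testBit 0).toNat) / 2 * ∫ x in (0 : ℝ)..1, walsh (k / 2) x := by
  have hleft : ∫ x in (0 : ℝ)..(1 / 2), walsh k x =
      1 / 2 * ∫ x in (0 : ℝ)..1, walsh (k / 2) x := by
    have hcongr : ∫ x in (0 : ℝ)..(1 / 2), walsh k x =
        ∫ x in (0 : ℝ)..(1 / 2), walsh (k / 2) (2 * x) := by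
      refine intervalIntegral.integral_congr_Ioo_of_le (by norm_num) fun x hx => ?_
      simp [walsh_eq_mul_walsh_half hk x, dyadicDigit_one_of_lt_half hx.1.le hx.2]
    rw [hcongr, intervalIntegral.integral_comp_mul_left _ two_ne_zero]
    norm_num
  have hright : ∫ x in (1 / 2 : ℝ)..1, walsh k x =
      (-1) ^ (k.testBit 0).toNat * (1 / 2 * ∫ x in (0 : ℝ)..1, walsh (k / 2) x) := by
    have hcongr : ∫ x in (1 / 2 : ℝ)..1, walsh k x =
        ∫ x in (1 / 2 : ℝ)..1, (-1) ^ (k.testBit 0).toNat * walsh (k / 2) (2 * x - 1) := by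
      refine intervalIntegral.integral_congr_Ioo_of_le (by norm_num) fun x hx => ?_
      have hshift := walsh_add_one (k / 2) (x := 2 * x - 1) (by linarith [hx.1])
      rw [sub_add_cancel] at hshift
      simp only [walsh_eq_mul_walsh_half hk x, dyadicDigit_one_of_half_le hx.1.le hx.2, mul_one,
        hshift]
    rw [hcongr, intervalIntegral.integral_const_mul,
      intervalIntegral.integral_comp_mul_sub _ two_ne_zero]
    norm_num
  rw [← intervalIntegral.integral_add_adjacent_intervals (intervalIntegrable_walsh k 0 (1 / 2))
    (intervalIntegrable_walsh k (1 / 2) 1), hleft, hright]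
  ring

/-- Nonconstant Walsh functions have mean zero. -/
lemma integral_walsh_eq_zero {k : ℕ} (hk : 1 ≤ k) : ∫ x in (0 : ℝ)..1, walsh k x = 0 := by
  induction k using Nat.strong_induction_on with
  | _ k ih =>
    rw [integral_walsh_eq_half hk]
    rcases Nat.mod_two_eq_zero_or_one k with hmod | hmod
    · rw [ih (k / 2) (by omega) (by omega), mul_zero]
    · simp [Nat.testBit_zero, hmod]

lemma continuous_integral_walsh (k : ℕ) : Continuous fun x => ∫ t in (0 : ℝ)..x, walsh k t :=
  intervalIntegral.continuous_primitive (intervalIntegrable_walsh k) 0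

lemma intervalIntegrable_integral_walsh_mul_walsh (k : ℕ) (a b : ℝ) :
    IntervalIntegrable (fun x => (∫ t in (0 : ℝ)..x, walsh k t) * walsh k x) volume a b :=
  (intervalIntegrable_walsh k a b).continuousOn_mul (continuous_integral_walsh k).continuousOn

/-- The diagonal entry `⟨J w_k, w_k⟩` of the Volterra operator is half the squared mean of `w_k`. -/
lemma integral_integral_walsh_mul_walsh (k : ℕ) :
    ∫ x in (0 : ℝ)..1, (∫ t in (0 : ℝ)..x, walsh k t) * walsh k x =
      (∫ x in (0 : ℝ)..1, walsh k x) ^ 2 / 2 := by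
  have hderiv (x : ℝ) :
      HasDerivWithinAt (fun u => ∫ t in (0 : ℝ)..u, walsh k t) (walsh k x) (Ioi x) x :=
    (intervalIntegral.integral_hasDerivWithinAt_right (s := Ici x) (t := Ioi x)
      (intervalIntegrable_walsh k 0 x)
      (measurable_walsh k).stronglyMeasurable.stronglyMeasurableAtFilter
      ((continuousWithinAt_walsh_Ici k x).mono Ioi_subset_Ici_self)).mono Ioi_subset_Ici_self
  rw [intervalIntegral.integral_eq_sub_of_hasDeriv_right
    (f := fun x => (∫ t in (0 : ℝ)..x, walsh k t) ^ 2 / 2)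
    (((continuous_integral_walsh k).pow 2).div_const 2).continuousOn
    (fun x _ => (((hderiv x).pow 2).div_const 2).congr_deriv (by simp; ring))
    (intervalIntegrable_integral_walsh_mul_walsh k 0 1)]
  simp

lemma integral_sq_integral_walsh_sub (k : ℕ) (c : ℝ) :
    ∫ x in (0 : ℝ)..1, ((∫ t in (0 : ℝ)..x, walsh k t) - c * walsh k x) ^ 2 =
      (∫ x in (0 : ℝ)..1, (∫ t in (0 : ℝ)..x, walsh k t) ^ 2) -
        2 * c * (∫ x in (0 : ℝ)..1, (∫ t in (0 : ℝ)..x, walsh k t) * walsh k x) + c ^ 2 := by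
  have hexpand (x : ℝ) : ((∫ t in (0 : ℝ)..x, walsh k t) - c * walsh k x) ^ 2 =
      (∫ t in (0 : ℝ)..x, walsh k t) ^ 2 -
        2 * c * ((∫ t in (0 : ℝ)..x, walsh k t) * walsh k x) + c ^ 2 := by
    linear_combination c ^ 2 * walsh_mul_self k x
  have hsq : IntervalIntegrable (fun x => (∫ t in (0 : ℝ)..x, walsh k t) ^ 2) volume 0 1 :=
    ((continuous_integral_walsh k).pow 2).intervalIntegrable 0 1
  have hcross := (intervalIntegrable_integral_walsh_mul_walsh k 0 1).const_mul (2 * c)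
  simp only [hexpand]
  rw [intervalIntegral.integral_add (hsq.sub hcross) intervalIntegrable_const,
    intervalIntegral.integral_sub hsq hcross, intervalIntegral.integral_const_mul]
  simp

end WalshPrimitive

open MeasureTheory intervalIntegral in
/-- for the Volterra operator `J f(x) = ∫_0^x f(t) dt` on `L²([0,1])`:
the diagonal Walsh entries `⟨J w_k, w_k⟩` vanish for `k ≥ 1` and equal `1/2` for
`k = 0`; consequently, among operators diagonal in the Walsh basis (equivalently,
dyadic convolution operators) with coefficients `γ`, the Hilbert–Schmidt distance to
`J`, i.e. `Σ_k ‖J w_k - γ_k w_k‖²`, is minimized by `γ_0 = 1/2`, `γ_k = 0` (`k ≥ 1`),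
and the resulting best-approximating operator is the rank-one operator
`f ↦ (1/2) ∫_0^1 f(λ) dλ`. -/
theorem best_approx_volterra :
    (∀ k : ℕ, 1 ≤ k →
      ∫ x in (0:ℝ)..1, (∫ t in (0:ℝ)..x, walsh k t) * walsh k x = 0) ∧
    ((∫ x in (0:ℝ)..1, (∫ t in (0:ℝ)..x, walsh 0 t) * walsh 0 x) = 1 / 2) ∧
    (∀ γ : ℕ → ℝ, ∀ N : ℕ,
      ∑ k ∈ Finset.range N, ∫ x in (0:ℝ)..1,
          ((∫ t in (0:ℝ)..x, walsh k t) - (if k = 0 then (1:ℝ)/2 else 0) * walsh k x) ^ 2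
        ≤ ∑ k ∈ Finset.range N, ∫ x in (0:ℝ)..1,
            ((∫ t in (0:ℝ)..x, walsh k t) - γ k * walsh k x) ^ 2) ∧
    (∀ f : ℝ → ℝ, ∀ x : ℝ,
      ((1:ℝ)/2) * (∫ t in (0:ℝ)..1, f t * walsh 0 t) * walsh 0 x
        = (1/2) * ∫ t in (0:ℝ)..1, f t) := by
  have hpos : ∀ k : ℕ, 1 ≤ k →
      ∫ x in (0:ℝ)..1, (∫ t in (0:ℝ)..x, walsh k t) * walsh k x = 0 := fun k hk => by
    simp [integral_integral_walsh_mul_walsh, integral_walsh_eq_zero hk]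
  have hzero : (∫ x in (0:ℝ)..1, (∫ t in (0:ℝ)..x, walsh 0 t) * walsh 0 x) = 1 / 2 := by
    simp [walsh_zero]
  refine ⟨hpos, hzero, fun γ N => Finset.sum_le_sum fun k _ => ?_, fun f x => ?_⟩
  · rw [integral_sq_integral_walsh_sub, integral_sq_integral_walsh_sub]
    rcases Nat.eq_zero_or_pos k with rfl | hk
    · rw [hzero, if_pos rfl]
      nlinarith [sq_nonneg (γ 0 - 1 / 2)]
    · rw [hpos k hk, if_neg hk.ne']
      nlinarith [sq_nonneg (γ k)]
  · simp [walsh_zero]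
end
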